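/- Fix ε>0 and set K=(1/8−ε)N, R=N/4, Q=N/8. Suppose θ ∈ T satisfies |Σ_{f∈G_N} Λ_R(f+1)H_Q(f) e(fθ)| ≥ (1/3)·2^{N−K}. Then there exist polynomials u, s ∈ F₂[x] with deg s ≤ (1+ε)K + O_ε(log N) such that ord(θ − u/s) < −N. -/

import Mathlib

open Polynomial
open scoped Classical

noncomputable section

abbrev F2 := ZMod 2
abbrev Kinf := LaurentSeries F2
def polyToK (f : F2[X]) : Kinf :=
  ∑ i ∈ f.support, HahnSeries.single (-(i : ℤ)) (f.coeff i)
def ordK (a : Kinf) : WithBot ℤ := if a = 0 then ⊥ else (↑(-a.order) : WithBot ℤ)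
def eKr (a : Kinf) : ℝ := (-1 : ℝ) ^ ((a.coeff 1).val)
def eK (a : Kinf) : ℂ := ((eKr a : ℝ) : ℂ)
def InT (θ : Kinf) : Prop := ordK θ ≤ ((-1 : ℤ) : WithBot ℤ)
def GN (N : ℕ) : Finset F2[X] :=
  Set.Finite.toFinset (s := {f : F2[X] | f.degree < (N : ℕ)}) (by
    have h : {f : F2[X] | f.degree < (N : ℕ)} = ↑(Polynomial.degreeLT F2 N) := by
      ext f
      simp [Polynomial.mem_degreeLT]
    rw [h]
    have : Finite (Polynomial.degreeLT F2 N) :=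
      Finite.of_equiv _ (Polynomial.degreeLTEquiv F2 N).symm.toEquiv
    exact (Polynomial.degreeLT F2 N : Set F2[X]).toFinite)
def ratK (u s : F2[X]) : Kinf := polyToK u * (polyToK s)⁻¹

/-- τ(f): the number of divisors of `f`. -/
def tau (f : F2[X]) : ℕ := ((GN (f.natDegree + 1)).filter (fun g => g ∣ f)).card

/-- φ(f): the number of invertible residues modulo `f`. -/
def phi (f : F2[X]) : ℕ := ((GN f.natDegree).filter (fun g => IsCoprime g f)).card

/-- ω(f): the number of (irreducible nonconstant, i.e. prime) divisors of `f`. -/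
def omegaP (f : F2[X]) : ℕ :=
  ((GN (f.natDegree + 1)).filter (fun r => Irreducible r ∧ r ∣ f)).card

/-- The Möbius function on `F₂[x]`. -/
def mu (f : F2[X]) : ℤ := if Squarefree f then (-1) ^ (omegaP f) else 0

/-- The set of invertible residues modulo `s` (canonical representatives of
`(F₂[x]/(s))^×`, i.e. polynomials of degree `< deg s` coprime to `s`). -/
def residues (s : F2[X]) : Finset F2[X] := (GN s.natDegree).filter (fun t => IsCoprime t s)

/-- `α(s) = μ(s)/φ(s)`. -/
def alphaA (s : F2[X]) : ℝ := (mu s : ℝ) / (phi s : ℝ)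

/-- `α'(s) = ∏_{r | s prime} 3/(2^{deg r}+3)` for `s` squarefree, `0` otherwise. -/
def alphaB (s : F2[X]) : ℝ :=
  if Squarefree s then
    ∏ r ∈ (GN (s.natDegree + 1)).filter (fun r => Irreducible r ∧ r ∣ s),
      (3 : ℝ) / ((2 : ℝ) ^ r.natDegree + 3)
  else 0

/-- `Λ_M(f) = Σ_{s ∈ G_M} α(s) Σ_{t ∈ (F₂[x]/(s))^×} e(f t s⁻¹)`. -/
def LambdaM (M : ℕ) (f : F2[X]) : ℝ :=
  ∑ s ∈ GN M, alphaA s * ∑ t ∈ residues s, eKr (polyToK f * ratK t s)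

/-- `H_M(f) = Σ_{s ∈ G_M} α'(s) Σ_{t ∈ (F₂[x]/(s))^×} e(f t s⁻¹)`. -/
def HM (M : ℕ) (f : F2[X]) : ℝ :=
  ∑ s ∈ GN M, alphaB s * ∑ t ∈ residues s, eKr (polyToK f * ratK t s)

/-- `Λ'(f) = deg f` if `f` is prime, `0` otherwise. -/
def LambdaP (f : F2[X]) : ℝ := if Irreducible f then (f.natDegree : ℝ) else 0

/-- `Ψ(f) = Λ'(f+1) H_Q(f) 1_{f ∈ G_N}`. -/
def Psi (N Q : ℕ) (f : F2[X]) : ℝ :=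
  LambdaP (f + 1) * HM Q f * (if f ∈ GN N then 1 else 0)

/-- `Ψ'(f) = Λ_R(f+1) H_Q(f) 1_{f ∈ G_N}`. -/
def Psi' (N R Q : ℕ) (f : F2[X]) : ℝ :=
  LambdaM R (f + 1) * HM Q f * (if f ∈ GN N then 1 else 0)

/-- `Λ_r(f)` for a single prime `r`. -/
def Lambda_r (r f : F2[X]) : ℝ :=
  if r ∣ f then 0 else (2 : ℝ) ^ r.natDegree / ((2 : ℝ) ^ r.natDegree - 1)

/-- `τ²_r(f)` for a single prime `r`. -/
def tauSq_r (r f : F2[X]) : ℝ :=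
  if r ∣ f then 4 * (2 : ℝ) ^ r.natDegree / ((2 : ℝ) ^ r.natDegree + 3)
  else (2 : ℝ) ^ r.natDegree / ((2 : ℝ) ^ r.natDegree + 3)

/-- `˜Λ_M(f) = ∏_{r ∈ G_M prime} Λ_r(f)`. -/
def LambdaTilde (M : ℕ) (f : F2[X]) : ℝ :=
  ∏ r ∈ (GN M).filter (fun r => Irreducible r), Lambda_r r f

/-- `˜H_M(f) = ∏_{r ∈ G_M prime} τ²_r(f)`. -/
def HTilde (M : ℕ) (f : F2[X]) : ℝ :=
  ∏ r ∈ (GN M).filter (fun r => Irreducible r), tauSq_r r f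

/-- The element of `K∞` determined by a rational function (with `x ↦ t⁻¹`). -/
def ratToK (l : RatFunc F2) : Kinf := polyToK l.num * (polyToK l.denom)⁻¹

/-- `c : F₂(x)/F₂[x] → ℝ` (encoded on the canonical representatives
`λ = num/denom` in lowest terms with `deg num < deg denom`) is the system of Fourier
coefficients of `F : F₂[x] → ℝ`, i.e. `F(f) = Σ_λ c(λ) e(λ f)`. -/
def IsFourierCoeffs (F : F2[X] → ℝ) (c : RatFunc F2 → ℝ) : Prop :=
  (Function.support c).Finite ∧
  (∀ l : RatFunc F2, c l ≠ 0 → (l.num).degree < (l.denom).degree) ∧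
  ∀ f : F2[X], F f = ∑ᶠ l : RatFunc F2, c l * eKr (ratToK l * polyToK f)

/-- The canonical representative (mod `F₂[x]`) of a rational function. -/
def fracRat (l : RatFunc F2) : RatFunc F2 :=
  l - algebraMap F2[X] (RatFunc F2) (l.num / l.denom)

/-- `c(n, η)` from the statement of the exponential sum estimate for `Λ'`. -/
def cFun (n : ℕ) (η : Kinf) : ℝ :=
  if ordK η < ((-(n : ℤ) - 1 : ℤ) : WithBot ℤ) then 1
  else if ordK η = ((-(n : ℤ) - 1 : ℤ) : WithBot ℤ) then -1
  else 0

/-- The class `C_B(X)` (with explicit implied constant `Cst`): functions whose Fourier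
coefficients are supported on `λ` with squarefree denominator of degree `≤ X` and satisfy
`|c(λ)| ≤ Cst · τ(denom λ)^B / 2^{deg (denom λ)}`. -/
def InClassC (B X : ℕ) (Cst : ℝ) (F : F2[X] → ℝ) : Prop :=
  ∃ c : RatFunc F2 → ℝ, IsFourierCoeffs F c ∧
    (∀ l : RatFunc F2, c l ≠ 0 → Squarefree l.denom ∧ (l.denom).natDegree ≤ X) ∧
    (∀ l : RatFunc F2, |c l| ≤ Cst * (tau l.denom : ℝ) ^ B / 2 ^ (l.denom).natDegree)

/-- The fractional part `‖θ‖` of `θ ∈ K∞`: keep exactly the coefficients of `x^{-n}`, `n ≥ 1`. -/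
def fracK (θ : Kinf) : Kinf :=
  ⟨fun n => if 1 ≤ n then θ.coeff n else 0, by
    apply θ.isPWO_support'.mono
    intro n hn
    simp only [Function.mem_support, ne_eq] at hn ⊢
    intro h
    apply hn
    split_ifs
    · exact h
    · rfl⟩

lemma mem_GN {N : ℕ} {f : F2[X]} : f ∈ GN N ↔ f.degree < (N : ℕ) := by
  simp [GN]

lemma mem_GN_ne {N : ℕ} {f : F2[X]} (hf : f ≠ 0) : f ∈ GN N ↔ f.natDegree < N := by
  rw [mem_GN, Polynomial.degree_eq_natDegree hf]
  exact_mod_cast Iff.rfl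

lemma card_GN (N : ℕ) : (GN N).card = 2 ^ N := by
  have h : ((GN N : Finset F2[X]) : Set F2[X]) = (Polynomial.degreeLT F2 N : Set F2[X]) := by
    ext f
    simp [mem_GN, Polynomial.mem_degreeLT]
  have h2 : (GN N).card = Nat.card (Polynomial.degreeLT F2 N) := by
    rw [← Set.ncard_coe_finset, h]
    rfl
  rw [h2, Nat.card_congr (Polynomial.degreeLTEquiv F2 N).toEquiv]
  simp

lemma mem_tau {f g : F2[X]} (hf : f ≠ 0) :
    g ∈ (GN (f.natDegree + 1)).filter (fun g => g ∣ f) ↔ g ∣ f := by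
  simp only [Finset.mem_filter, and_iff_right_iff_imp]
  intro h
  have hg : g ≠ 0 := ne_zero_of_dvd_ne_zero hf h
  rw [mem_GN_ne hg]
  exact Nat.lt_succ_of_le (Polynomial.natDegree_le_of_dvd h hf)

lemma tau_mul_le {a b : F2[X]} (ha : a ≠ 0) (hb : b ≠ 0) : tau (a * b) ≤ tau a * tau b := by
  unfold tau
  rw [← Finset.card_product]
  refine le_trans (Finset.card_le_card (t := Finset.image (fun p : F2[X] × F2[X] => p.1 * p.2) _) ?_)
    Finset.card_image_le
  intro g hg
  rw [mem_tau (mul_ne_zero ha hb)] at hg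
  obtain ⟨x, y, hx, hy, rfl⟩ := exists_dvd_and_dvd_of_dvd_mul hg
  rw [Finset.mem_image]
  refine ⟨(x, y), ?_, rfl⟩
  rw [Finset.mem_product]
  exact ⟨(mem_tau ha).2 hx, (mem_tau hb).2 hy⟩

lemma tau_mono {a b : F2[X]} (hb : b ≠ 0) (h : a ∣ b) : tau a ≤ tau b := by
  unfold tau
  apply Finset.card_le_card
  intro g hg
  rw [mem_tau (ne_zero_of_dvd_ne_zero hb h)] at hg
  rw [mem_tau hb]
  exact hg.trans h

lemma one_le_tau {a : F2[X]} (ha : a ≠ 0) : 1 ≤ tau a := by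
  unfold tau
  rw [Nat.one_le_iff_ne_zero, ← Nat.pos_iff_ne_zero, Finset.card_pos]
  exact ⟨a, (mem_tau ha).2 dvd_rfl⟩

/-- nonzero polynomials of degree less than `N` -/
def GZ (N : ℕ) : Finset F2[X] := (GN N).filter (fun f => f ≠ 0)

lemma mem_GZ {N : ℕ} {f : F2[X]} : f ∈ GZ N ↔ f ≠ 0 ∧ f.natDegree < N := by
  unfold GZ
  rw [Finset.mem_filter]
  constructor
  · rintro ⟨h, h0⟩
    exact ⟨h0, (mem_GN_ne h0).1 h⟩
  · rintro ⟨h0, h⟩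
    exact ⟨(mem_GN_ne h0).2 h, h0⟩

/-- weight `τ(h)^k / |h|` -/
def wt (k : ℕ) (h : F2[X]) : ℝ := (tau h : ℝ) ^ k / 2 ^ h.natDegree

lemma wt_nonneg (k : ℕ) (h : F2[X]) : 0 ≤ wt k h := by unfold wt; positivity

lemma wt_mul_le (k : ℕ) {a b : F2[X]} (ha : a ≠ 0) (hb : b ≠ 0) :
    wt k (a * b) ≤ wt k a * wt k b := by
  unfold wt
  rw [Polynomial.natDegree_mul ha hb, pow_add, div_mul_div_comm, ← mul_pow]
  gcongr
  exact_mod_cast tau_mul_le ha hb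

def Ssum (k N : ℕ) : ℝ := ∑ h ∈ GZ N, wt k h

lemma Ssum_nonneg (k N : ℕ) : 0 ≤ Ssum k N := Finset.sum_nonneg fun _ _ => wt_nonneg _ _

lemma sum_dvd_le (k N : ℕ) {d : F2[X]} (hd : d ≠ 0) :
    ∑ h ∈ (GZ N).filter (fun h => d ∣ h), wt k h ≤ wt k d * Ssum k N := by
  unfold Ssum
  rw [Finset.mul_sum]
  have : (GZ N).filter (fun h => d ∣ h) ⊆ ((GZ N).filter (fun e => d * e ∈ GZ N)).image (fun e => d * e) := by
    intro h hh
    rw [Finset.mem_filter] at hh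
    obtain ⟨hh, e, rfl⟩ := hh
    rw [Finset.mem_image]
    refine ⟨e, ?_, rfl⟩
    rw [Finset.mem_filter]
    refine ⟨?_, hh⟩
    rw [mem_GZ] at hh ⊢
    have he : e ≠ 0 := right_ne_zero_of_mul hh.1
    refine ⟨he, ?_⟩
    have := hh.2
    rw [Polynomial.natDegree_mul hd he] at this
    omega
  refine le_trans (Finset.sum_le_sum_of_subset_of_nonneg this fun _ _ _ => wt_nonneg _ _) ?_
  rw [Finset.sum_image (fun x _ y _ h => mul_left_cancel₀ hd h)]
  refine le_trans (Finset.sum_le_sum fun e he => wt_mul_le k hd (mem_GZ.1 (Finset.mem_filter.1 he).1).1) ?_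
  exact Finset.sum_le_sum_of_subset_of_nonneg (Finset.filter_subset _ _)
    fun _ _ _ => mul_nonneg (wt_nonneg _ _) (wt_nonneg _ _)

lemma wt_succ (k N : ℕ) {h : F2[X]} (hh : h ∈ GZ N) :
    wt (k + 1) h = ∑ d ∈ (GZ N).filter (fun d => d ∣ h), wt k h := by
  have h0 := mem_GZ.1 hh
  have : (GZ N).filter (fun d => d ∣ h) = (GN (h.natDegree + 1)).filter (fun g => g ∣ h) := by
    ext d
    rw [mem_tau h0.1, Finset.mem_filter, and_iff_right_iff_imp]
    intro hd
    rw [mem_GZ]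
    exact ⟨ne_zero_of_dvd_ne_zero h0.1 hd,
      lt_of_le_of_lt (Polynomial.natDegree_le_of_dvd hd h0.1) h0.2⟩
  rw [this, Finset.sum_const, nsmul_eq_mul]
  unfold wt
  rw [pow_succ]
  unfold tau
  ring

lemma Ssum_succ (k N : ℕ) : Ssum (k + 1) N ≤ Ssum k N ^ 2 := by
  calc Ssum (k + 1) N = ∑ h ∈ GZ N, ∑ d ∈ (GZ N).filter (fun d => d ∣ h), wt k h :=
        Finset.sum_congr rfl fun h hh => wt_succ k N hh
    _ = ∑ d ∈ GZ N, ∑ h ∈ (GZ N).filter (fun h => d ∣ h), wt k h := by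
        simp only [Finset.sum_filter]
        rw [Finset.sum_comm]
    _ ≤ ∑ d ∈ GZ N, wt k d * Ssum k N :=
        Finset.sum_le_sum fun d hd => sum_dvd_le k N (mem_GZ.1 hd).1
    _ = Ssum k N ^ 2 := by
        rw [← Finset.sum_mul, sq]; rfl

lemma GN_mono {m n : ℕ} (h : m ≤ n) : GN m ⊆ GN n := by
  intro f hf
  rw [mem_GN] at *
  exact lt_of_lt_of_le hf (by exact_mod_cast h)

lemma Ssum_zero (N : ℕ) : Ssum 0 N ≤ N := by
  induction N with
  | zero =>
    unfold Ssum
    rw [Finset.sum_eq_zero]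
    · simp
    · intro h hh
      exact absurd (mem_GZ.1 hh).2 (by omega)
  | succ n ih =>
    have hsub : GZ (n + 1) ⊆ GZ n ∪ (GN (n + 1) \ GN n) := by
      intro h hh
      have h1 := mem_GZ.1 hh
      by_cases h2 : h.natDegree < n
      · exact Finset.mem_union_left _ (mem_GZ.2 ⟨h1.1, h2⟩)
      · apply Finset.mem_union_right
        rw [Finset.mem_sdiff, mem_GN_ne h1.1, mem_GN_ne h1.1]
        exact ⟨h1.2, h2⟩
    have h3 : ∑ h ∈ GN (n + 1) \ GN n, wt 0 h ≤ 1 := by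
      have : ∀ h ∈ GN (n + 1) \ GN n, wt 0 h = 1 / 2 ^ n := by
        intro h hh
        rw [Finset.mem_sdiff] at hh
        have h0 : h ≠ 0 := by
          rintro rfl
          apply hh.2
          rw [mem_GN]; simp
        rw [mem_GN_ne h0, mem_GN_ne h0] at hh
        have : h.natDegree = n := by omega
        unfold wt
        rw [this]; simp
      rw [Finset.sum_congr rfl this, Finset.sum_const,
        Finset.card_sdiff_of_subset (GN_mono (Nat.le_succ n)), card_GN, card_GN]
      have : 2 ^ (n + 1) - 2 ^ n = 2 ^ n := by rw [pow_succ]; omega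
      rw [this]
      simp
    calc Ssum 0 (n + 1) ≤ ∑ h ∈ GZ n ∪ (GN (n + 1) \ GN n), wt 0 h :=
          Finset.sum_le_sum_of_subset_of_nonneg hsub fun _ _ _ => wt_nonneg _ _
      _ ≤ ∑ h ∈ GZ n, wt 0 h + ∑ h ∈ GN (n + 1) \ GN n, wt 0 h := by
          rw [← Finset.sum_union_inter]
          exact le_add_of_nonneg_right (Finset.sum_nonneg fun _ _ => wt_nonneg _ _)
      _ ≤ n + 1 := add_le_add ih h3
      _ = ((n + 1 : ℕ) : ℝ) := by push_cast; rfl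

lemma Ssum_le (k N : ℕ) : Ssum k N ≤ (N : ℝ) ^ (2 ^ k) := by
  induction k with
  | zero => simpa using Ssum_zero N
  | succ k ih =>
    refine (Ssum_succ k N).trans ?_
    rw [pow_succ 2 k, pow_mul]
    exact pow_le_pow_left₀ (Ssum_nonneg _ _) ih 2

lemma wt_le (k N : ℕ) {h : F2[X]} (hh : h ∈ GZ N) : wt k h ≤ (N : ℝ) ^ (2 ^ k) :=
  (Finset.single_le_sum (f := wt k) (fun _ _ => wt_nonneg _ _) hh).trans (Ssum_le k N)

lemma two_pow_le_phi_mul_tau {s : F2[X]} (hs : Squarefree s) :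
    2 ^ s.natDegree ≤ phi s * tau s := by
  have hs0 : s ≠ 0 := hs.ne_zero
  rw [← card_GN]
  unfold tau phi
  refine Finset.card_le_mul_card_image_of_maps_to (f := fun g => EuclideanDomain.gcd g s) ?_ _ ?_
  · intro g _
    exact (mem_tau hs0).2 (EuclideanDomain.gcd_dvd_right g s)
  · intro d hd
    obtain ⟨e, he⟩ := (mem_tau hs0).1 hd
    refine Finset.card_le_card_of_injOn (fun g => (g + e) % s) ?_ ?_
    · intro g hg
      rw [Finset.mem_coe, Finset.mem_filter] at hg
      obtain ⟨hg, hgd⟩ := hg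
      rw [Finset.mem_coe, Finset.mem_filter, mem_GN]
      constructor
      · rw [← Polynomial.degree_eq_natDegree hs0]
        exact EuclideanDomain.mod_lt _ hs0
      · have hcop : IsCoprime (g + e) s := by
          have hde : IsCoprime d e := by
            rw [← isRelPrime_iff_isCoprime]
            rw [he] at hs
            exact (squarefree_mul_iff.1 hs).1
          have hge : IsCoprime g e := by
            rw [← isRelPrime_iff_isCoprime]
            intro c hcg hce
            have hcs : c ∣ s := he ▸ hce.mul_left d
            have hcd : c ∣ d := hgd ▸ EuclideanDomain.dvd_gcd hcg hcs
            exact hde.isRelPrime hcd hce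
          rw [he]
          apply IsCoprime.mul_right
          · have hdg : d ∣ g := hgd ▸ EuclideanDomain.gcd_dvd_left g s
            obtain ⟨g1, rfl⟩ := hdg
            rw [add_comm]
            exact IsCoprime.add_mul_left_left hde.symm g1
          · have := IsCoprime.add_mul_left_left hge 1
            simpa using this
        have h2 : g + e = (g + e) % s + s * ((g + e) / s) := (EuclideanDomain.mod_add_div _ _).symm
        rw [h2] at hcop
        exact IsCoprime.of_add_mul_left_left hcop
    · intro g hg g' hg' hgg
      rw [Finset.mem_coe, Finset.mem_filter, mem_GN, ← Polynomial.degree_eq_natDegree hs0] at hg hg'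
      have h2 : g + e = (g + e) % s + s * ((g + e) / s) := (EuclideanDomain.mod_add_div _ _).symm
      have h3 : g' + e = (g' + e) % s + s * ((g' + e) / s) := (EuclideanDomain.mod_add_div _ _).symm
      have hgg' : (g + e) % s = (g' + e) % s := hgg
      have hdvd : s ∣ g - g' := ⟨(g + e) / s - (g' + e) / s, by
        rw [hgg'] at h2
        linear_combination h2 - h3⟩
      have hlt : (g - g').degree < s.degree :=
        lt_of_le_of_lt (Polynomial.degree_sub_le _ _) (max_lt hg.1 hg'.1)
      exact sub_eq_zero.1 (Polynomial.eq_zero_of_dvd_of_degree_lt hdvd hlt)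

lemma abs_alphaA_le {s : F2[X]} (hs : s ≠ 0) : |alphaA s| ≤ wt 1 s := by
  unfold alphaA mu
  split_ifs with h
  · have h1 := two_pow_le_phi_mul_tau h
    have hphi : 0 < phi s := by
      rcases Nat.eq_zero_or_pos (phi s) with h0 | h0
      · rw [h0, zero_mul] at h1
        have : 0 < 2 ^ s.natDegree := by positivity
        omega
      · exact h0
    have hphi' : (0 : ℝ) < phi s := by exact_mod_cast hphi
    have h1' : (2 : ℝ) ^ s.natDegree ≤ phi s * tau s := by exact_mod_cast h1
    rw [abs_div]
    push_cast
    rw [abs_pow, abs_neg, abs_one, one_pow, abs_of_pos hphi']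
    unfold wt
    rw [pow_one, div_le_div_iff₀ hphi' (by positivity)]
    linarith
  · simpa using wt_nonneg 1 s

lemma alphaA_zero : alphaA 0 = 0 := by
  simp [alphaA, mu]

lemma alphaB_zero : alphaB 0 = 0 := by
  simp [alphaB]

lemma F2_monic {p : F2[X]} (hp : p ≠ 0) : p.Monic := by
  have h : p.leadingCoeff ≠ 0 := Polynomial.leadingCoeff_ne_zero.2 hp
  have : ∀ a : F2, a ≠ 0 → a = 1 := by decide
  exact this _ h

lemma F2_assoc {p q : F2[X]} (hp : p ≠ 0) (h : Associated p q) : p = q :=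
  Polynomial.eq_of_monic_of_associated (F2_monic hp)
    (F2_monic (fun hq => hp (by rw [hq] at h; exact (associated_zero_iff_eq_zero p).1 h))) h

lemma squarefree_dvd_prod {s : F2[X]} (hs : Squarefree s) :
    s ∣ ∏ r ∈ (GN (s.natDegree + 1)).filter (fun r => Irreducible r ∧ r ∣ s), r := by
  have h1 : s ∣ UniqueFactorizationMonoid.radical s :=
    IsRadical.dvd_radical hs.isRadical hs.ne_zero
  refine h1.trans ?_
  unfold UniqueFactorizationMonoid.radical
  apply Finset.prod_dvd_prod_of_subset
  intro r hr
  rw [UniqueFactorizationMonoid.mem_primeFactors] at hr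
  have hd := UniqueFactorizationMonoid.dvd_of_mem_normalizedFactors hr
  have hi := UniqueFactorizationMonoid.irreducible_of_normalized_factor _ hr
  have := (mem_tau hs.ne_zero).2 hd
  rw [Finset.mem_filter] at this ⊢
  exact ⟨this.1, hi, hd⟩

lemma two_pow_card_le_tau {s : F2[X]} (hs : s ≠ 0) :
    2 ^ ((GN (s.natDegree + 1)).filter (fun r => Irreducible r ∧ r ∣ s)).card ≤ tau s := by
  set P := (GN (s.natDegree + 1)).filter (fun r => Irreducible r ∧ r ∣ s) with hP
  have hPm : ∀ r ∈ P, Irreducible r ∧ r ∣ s := fun r hr => (Finset.mem_filter.1 hr).2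
  rw [← Finset.card_powerset]
  unfold tau
  refine Finset.card_le_card_of_injOn (fun A => ∏ r ∈ A, r) ?_ ?_
  · intro A hA
    rw [Finset.mem_coe, Finset.mem_powerset] at hA
    rw [Finset.mem_coe, mem_tau hs]
    apply Finset.prod_dvd_of_coprime
    · intro a ha b hb hab
      have ia := (hPm a (hA ha)).1
      have ib := (hPm b (hA hb)).1
      show IsCoprime a b
      rw [Irreducible.coprime_iff_not_dvd ia]
      intro hd
      exact hab (F2_assoc ia.ne_zero (ia.associated_of_dvd ib hd))
    · intro a ha
      exact (hPm a (hA ha)).2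
  · have key : ∀ A ⊆ P, ∀ B ⊆ P, ∏ r ∈ A, r = ∏ r ∈ B, r → A ⊆ B := by
      intro A hA B hB h r hr
      have ir := (hPm r (hA hr)).1
      have : r ∣ ∏ r ∈ B, r := h ▸ Finset.dvd_prod_of_mem (fun r => r) hr
      obtain ⟨b, hb, hrb⟩ := (Prime.dvd_finsetProd_iff ir.prime _).1 this
      have ib := (hPm b (hB hb)).1
      rw [F2_assoc ir.ne_zero (ir.associated_of_dvd ib hrb)]
      exact hb
    intro A hA B hB h
    rw [Finset.mem_coe, Finset.mem_powerset] at hA hB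
    exact Finset.Subset.antisymm (key A hA B hB h) (key B hB A hA h.symm)

lemma abs_alphaB_le {s : F2[X]} : |alphaB s| ≤ wt 2 s := by
  unfold alphaB
  split_ifs with h
  · have hs := h.ne_zero
    have h1 := squarefree_dvd_prod h
    have h2 := two_pow_card_le_tau hs
    set P := (GN (s.natDegree + 1)).filter (fun r => Irreducible r ∧ r ∣ s) with hP
    have hPm : ∀ r ∈ P, Irreducible r ∧ r ∣ s := fun r hr => (Finset.mem_filter.1 hr).2
    have hne : ∏ r ∈ P, r ≠ 0 := Finset.prod_ne_zero_iff.2 fun r hr => (hPm r hr).1.ne_zero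
    have hdeg := Polynomial.natDegree_le_of_dvd h1 hne
    rw [Polynomial.natDegree_prod _ _ fun r hr => (hPm r hr).1.ne_zero] at hdeg
    rw [abs_of_nonneg (Finset.prod_nonneg fun _ _ => by positivity)]
    calc ∏ r ∈ P, (3 : ℝ) / ((2 : ℝ) ^ r.natDegree + 3)
        ≤ ∏ r ∈ P, (4 : ℝ) / (2 : ℝ) ^ r.natDegree := by
          apply Finset.prod_le_prod
          · intro _ _; positivity
          · intro r _
            apply div_le_div₀ <;> first | positivity | linarith
      _ = (2 ^ P.card) ^ 2 / 2 ^ (∑ r ∈ P, r.natDegree) := by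
          rw [Finset.prod_div_distrib, Finset.prod_const, Finset.prod_pow_eq_pow_sum, ← pow_mul,
            mul_comm, pow_mul]
          norm_num
      _ ≤ wt 2 s := by
          unfold wt
          have h2' : (2 : ℝ) ^ P.card ≤ tau s := by exact_mod_cast h2
          gcongr
          norm_num
  · simpa using wt_nonneg 2 s

/-- `polyToK` as a ring homomorphism -/
def pK : F2[X] →+* Kinf := Polynomial.eval₂RingHom (HahnSeries.C) (HahnSeries.single (-1 : ℤ) (1 : F2))

lemma polyToK_eq (f : F2[X]) : polyToK f = pK f := by
  unfold polyToK pK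
  rw [Polynomial.coe_eval₂RingHom, Polynomial.eval₂_eq_sum, Polynomial.sum]
  refine Finset.sum_congr rfl fun i _ => ?_
  rw [HahnSeries.single_pow, HahnSeries.C_apply, HahnSeries.single_mul_single]
  simp

lemma coeff_pK (f : F2[X]) (i : ℕ) : (pK f).coeff (-(i : ℤ)) = f.coeff i := by
  rw [← polyToK_eq, polyToK, HahnSeries.coeff_sum]
  simp only [HahnSeries.coeff_single, neg_inj, Nat.cast_inj]
  rw [Finset.sum_ite_eq]
  simp only [Polynomial.mem_support_iff, ne_eq, ite_not, ite_eq_right_iff]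
  exact fun h => h.symm

lemma coeff_pK_pos (f : F2[X]) (n : ℤ) (hn : 0 < n) : (pK f).coeff n = 0 := by
  rw [← polyToK_eq, polyToK, HahnSeries.coeff_sum]
  apply Finset.sum_eq_zero
  intro i _
  rw [HahnSeries.coeff_single, if_neg]
  omega

lemma pK_inj {f g : F2[X]} (h : pK f = pK g) : f = g := by
  ext i
  rw [← coeff_pK, h, coeff_pK]

lemma pK_ne {f : F2[X]} (h : f ≠ 0) : pK f ≠ 0 := fun h0 => h (pK_inj (by rw [h0, map_zero]))

lemma order_pK {f : F2[X]} (h : f ≠ 0) : (pK f).order = -(f.natDegree : ℤ) := by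
  apply le_antisymm
  · apply HahnSeries.order_le_of_coeff_ne_zero
    rw [coeff_pK]
    exact Polynomial.leadingCoeff_ne_zero.2 h
  · by_contra! hlt
    have hne := HahnSeries.coeff_order_eq_zero.not.2 (pK_ne h)
    by_cases h2 : 0 < (pK f).order
    · exact hne (coeff_pK_pos _ _ h2)
    · obtain ⟨i, hi⟩ : ∃ i : ℕ, (pK f).order = -(i : ℤ) := ⟨(-(pK f).order).toNat, by omega⟩
      rw [hi, coeff_pK] at hne
      rw [hi] at hlt
      exact hne (Polynomial.coeff_eq_zero_of_natDegree_lt (by omega))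

lemma eKr_add (a b : Kinf) : eKr (a + b) = eKr a * eKr b := by
  unfold eKr
  rw [HahnSeries.coeff_add]
  generalize a.coeff 1 = x
  generalize b.coeff 1 = y
  revert x y
  have : ∀ x : F2, x = 0 ∨ x = 1 := by decide
  intro x y
  rcases this x with rfl | rfl <;> rcases this y with rfl | rfl
  · norm_num
  · norm_num
  · norm_num
  · have h : (1 : F2) + 1 = 0 := by decide
    have h1 : (1 : F2).val = 1 := by decide
    rw [h, h1]; norm_num

lemma abs_eKr (a : Kinf) : |eKr a| = 1 := by
  unfold eKr
  rw [abs_pow, abs_neg, abs_one, one_pow]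

/-- The character sum over `G_N`. -/
def Esum (N : ℕ) (β : Kinf) : ℝ := ∑ f ∈ GN N, eKr (pK f * β)

lemma abs_Esum_le (N : ℕ) (β : Kinf) : |Esum N β| ≤ 2 ^ N := by
  unfold Esum
  refine (Finset.abs_sum_le_sum_abs _ _).trans ?_
  simp only [abs_eKr, Finset.sum_const, card_GN, nsmul_eq_mul, mul_one]
  push_cast
  exact le_rfl

/-- vanishing of the first `N` fractional coefficients -/
def Near (N : ℕ) (β : Kinf) : Prop := ∀ j : ℤ, 1 ≤ j → j ≤ N → β.coeff j = 0

lemma Esum_eq_zero (N : ℕ) (β : Kinf) (h : ¬ Near N β) : Esum N β = 0 := by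
  unfold Near at h
  push Not at h
  obtain ⟨j, h1, h2, h3⟩ := h
  obtain ⟨i, rfl⟩ : ∃ i : ℕ, j = 1 + i := ⟨(j - 1).toNat, by omega⟩
  have hX : (X ^ i : F2[X]) ∈ GN N := by
    rw [mem_GN, Polynomial.degree_X_pow]
    exact_mod_cast (by omega : i < N)
  have he : eKr (pK (X ^ i) * β) = -1 := by
    have hX' : pK (X ^ i) = HahnSeries.single (-(i : ℤ)) (1 : F2) := by
      rw [map_pow]
      unfold pK
      rw [Polynomial.coe_eval₂RingHom, Polynomial.eval₂_X, HahnSeries.single_pow]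
      simp
    unfold eKr
    rw [hX', HahnSeries.coeff_single_mul]
    have : ∀ x : F2, x ≠ 0 → x = 1 := by decide
    rw [sub_neg_eq_add, one_mul, this _ h3]
    have h1 : (1 : F2).val = 1 := by decide
    rw [h1]; norm_num
  have hs : Esum N β = ∑ f ∈ GN N, eKr (pK (f + X ^ i) * β) := by
    unfold Esum
    have hclosed : ∀ f ∈ GN N, f + X ^ i ∈ GN N := by
      intro f hf
      rw [mem_GN] at *
      exact lt_of_le_of_lt (Polynomial.degree_add_le _ _) (max_lt hf hX)
    have hinv : ∀ f : F2[X], f + X ^ i + X ^ i = f := by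
      intro f
      rw [add_assoc, CharTwo.add_self_eq_zero, add_zero]
    refine Finset.sum_bij' (fun f _ => f + X ^ i) (fun f _ => f + X ^ i) hclosed hclosed
      (fun f _ => hinv f) (fun f _ => hinv f) ?_
    intro f _
    rw [hinv]
  have hs2 : Esum N β = - Esum N β := by
    conv_lhs => rw [hs]
    unfold Esum
    rw [← Finset.sum_neg_distrib]
    refine Finset.sum_congr rfl fun f _ => ?_
    rw [map_add, add_mul, eKr_add, he]
    ring
  linarith

lemma ratK_eq (u s : F2[X]) : ratK u s = pK u / pK s := by
  unfold ratK
  rw [polyToK_eq, polyToK_eq, div_eq_mul_inv]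

/-- a rational with small denominator, zero to high order, vanishes -/
lemma eq_zero_of_near {N : ℕ} {a : Kinf} {p q : F2[X]} (hq : q ≠ 0) (hd : q.natDegree ≤ N)
    (h : a * pK q = pK p) (ha : ∀ j : ℤ, j ≤ N → a.coeff j = 0) : a = 0 := by
  by_contra h0
  have h1 : (N : ℤ) < a.order := by
    by_contra! h2
    exact HahnSeries.coeff_order_eq_zero.not.2 h0 (ha _ h2)
  have hp : p ≠ 0 := by
    rintro rfl
    rw [map_zero] at h
    exact mul_ne_zero h0 (pK_ne hq) h
  have h2 := HahnSeries.order_mul h0 (pK_ne hq)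
  rw [h, order_pK hp, order_pK hq] at h2
  omega

lemma coeff_ratio {t s : F2[X]} (hs : s ≠ 0) (hts : t.degree < s.degree) {j : ℤ} (hj : j ≤ 0) :
    (pK t / pK s).coeff j = 0 := by
  by_cases ht : t = 0
  · subst ht; simp
  have h0 : pK t / pK s ≠ 0 := div_ne_zero (pK_ne ht) (pK_ne hs)
  apply HahnSeries.coeff_eq_zero_of_lt_order
  have h2 := HahnSeries.order_mul h0 (pK_ne hs)
  rw [div_mul_cancel₀ _ (pK_ne hs), order_pK ht, order_pK hs] at h2
  have := Polynomial.natDegree_lt_natDegree ht hts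
  omega

lemma ordK_lt {a : Kinf} {N : ℕ} (h : ∀ j : ℤ, j ≤ N → a.coeff j = 0) :
    ordK a < ((-(N : ℤ) : ℤ) : WithBot ℤ) := by
  unfold ordK
  split_ifs with h0
  · exact WithBot.bot_lt_coe _
  · have h1 : (N : ℤ) < a.order := by
      by_contra! h2
      exact HahnSeries.coeff_order_eq_zero.not.2 h0 (h _ h2)
    exact_mod_cast (by omega : -a.order < -(N : ℤ))

lemma InT_coeff {θ : Kinf} (h : InT θ) {j : ℤ} (hj : j ≤ 0) : θ.coeff j = 0 := by
  unfold InT ordK at h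
  split_ifs at h with h0
  · rw [h0]; simp
  · have : -θ.order ≤ -1 := by exact_mod_cast h
    exact HahnSeries.coeff_eq_zero_of_lt_order (by omega)

lemma near_eq {N : ℕ} (s t s' t' s1 t1 s1' t1' : F2[X]) (θ : Kinf)
    (hs : s ∈ GZ (N / 4)) (hs' : s' ∈ GZ (N / 8)) (hs1 : s1 ∈ GZ (N / 4)) (hs1' : s1' ∈ GZ (N / 8))
    (ht : t ∈ residues s) (ht' : t' ∈ residues s') (ht1 : t1 ∈ residues s1)
    (ht1' : t1' ∈ residues s1')
    (h : Near N (pK t / pK s + pK t' / pK s' + θ))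
    (h1 : Near N (pK t1 / pK s1 + pK t1' / pK s1' + θ)) :
    pK t / pK s + pK t' / pK s' = pK t1 / pK s1 + pK t1' / pK s1' := by
  rw [mem_GZ] at hs hs' hs1 hs1'
  have hres : ∀ s t : F2[X], s ≠ 0 → t ∈ residues s → t.degree < s.degree := by
    intro s t hs ht
    unfold residues at ht
    rw [Finset.mem_filter, mem_GN, ← Polynomial.degree_eq_natDegree hs] at ht
    exact ht.1
  rw [← sub_eq_zero]
  refine eq_zero_of_near (N := N) (q := s * s' * s1 * s1')
    (p := (t * s' + t' * s) * (s1 * s1') - (t1 * s1' + t1' * s1) * (s * s')) ?_ ?_ ?_ ?_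
  · exact mul_ne_zero (mul_ne_zero (mul_ne_zero hs.1 hs'.1) hs1.1) hs1'.1
  · refine Polynomial.natDegree_mul_le.trans ?_
    have h2 := Polynomial.natDegree_mul_le (p := s * s') (q := s1)
    have h3 := Polynomial.natDegree_mul_le (p := s) (q := s')
    omega
  · have e1 := pK_ne hs.1
    have e2 := pK_ne hs'.1
    have e3 := pK_ne hs1.1
    have e4 := pK_ne hs1'.1
    simp only [map_mul, map_sub, map_add]
    field_simp
    try ring
  · intro j hj
    by_cases hj1 : 1 ≤ j
    · have a1 := h j hj1 hj
      have a2 := h1 j hj1 hj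
      have : pK t / pK s + pK t' / pK s' - (pK t1 / pK s1 + pK t1' / pK s1') =
        (pK t / pK s + pK t' / pK s' + θ) - (pK t1 / pK s1 + pK t1' / pK s1' + θ) := by ring
      rw [this, HahnSeries.coeff_sub, a1, a2, sub_zero]
    · have hj0 : j ≤ 0 := by omega
      rw [HahnSeries.coeff_sub, HahnSeries.coeff_add, HahnSeries.coeff_add,
        coeff_ratio hs.1 (hres _ _ hs.1 ht) hj0, coeff_ratio hs'.1 (hres _ _ hs'.1 ht') hj0,
        coeff_ratio hs1.1 (hres _ _ hs1.1 ht1) hj0, coeff_ratio hs1'.1 (hres _ _ hs1'.1 ht1') hj0]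
      simp

lemma card_pairs_le {g a b : F2[X]} (hg : g ≠ 0) (ha : a ≠ 0) (hb : b ≠ 0) (hab : IsCoprime a b)
    (C : Finset (F2[X] × F2[X])) (l : Kinf)
    (hC : ∀ p ∈ C, p.1.degree < (g * a).degree ∧
      pK p.1 / pK (g * a) + pK p.2 / pK (g * b) = l) :
    C.card ≤ 2 ^ g.natDegree := by
  rcases C.eq_empty_or_nonempty with rfl | ⟨q, hq⟩
  · simp
  rw [← card_GN]
  refine le_trans (Finset.card_le_card
    (t := (GN g.natDegree).image (fun w => (q.1 + a * w, q.2 - b * w))) ?_) Finset.card_image_le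
  intro p hp
  have h1 := (hC p hp).2
  rw [← (hC q hq).2] at h1
  have e1 := pK_ne hg
  have e2 := pK_ne ha
  have e3 := pK_ne hb
  have h2 : (p.1 - q.1) * b = (q.2 - p.2) * a := by
    apply pK_inj
    simp only [map_mul, map_sub] at h1 ⊢
    field_simp at h1
    linear_combination h1
  have h3 : a ∣ p.1 - q.1 := by
    apply hab.dvd_of_dvd_mul_right
    exact ⟨q.2 - p.2, by rw [h2, mul_comm]⟩
  obtain ⟨w, hw⟩ := h3
  have h4 : q.2 - p.2 = b * w := by
    apply mul_right_cancel₀ ha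
    rw [← h2, hw]; ring
  rw [Finset.mem_image]
  refine ⟨w, ?_, ?_⟩
  · rw [mem_GN, ← Polynomial.degree_eq_natDegree hg]
    have h5 : (a * w).degree < (g * a).degree := by
      rw [← hw]
      exact lt_of_le_of_lt (Polynomial.degree_sub_le _ _) (max_lt (hC p hp).1 (hC q hq).1)
    by_cases hw0 : w = 0
    · subst hw0
      rw [Polynomial.degree_zero]
      exact bot_lt_iff_ne_bot.2 (Polynomial.degree_ne_bot.2 hg)
    · have := Polynomial.natDegree_lt_natDegree (mul_ne_zero ha hw0) h5
      rw [Polynomial.natDegree_mul ha hw0, Polynomial.natDegree_mul hg ha] at this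
      exact Polynomial.degree_lt_degree (by omega)
  · ext1
    · show q.1 + a * w = p.1
      rw [← hw]; ring
    · show q.2 - b * w = p.2
      rw [← h4]; ring

lemma exists_gcd_form (x : F2[X]) {y : F2[X]} (hy : y ≠ 0) :
    ∃ g a b : F2[X], g ≠ 0 ∧ x = g * a ∧ y = g * b ∧ IsCoprime a b := by
  obtain ⟨a, ha⟩ := EuclideanDomain.gcd_dvd_left x y
  obtain ⟨b, hb⟩ := EuclideanDomain.gcd_dvd_right x y
  have hg : EuclideanDomain.gcd x y ≠ 0 := fun h => hy (EuclideanDomain.gcd_eq_zero_iff.1 h).2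
  have hbez := EuclideanDomain.gcd_eq_gcd_ab x y
  refine ⟨_, a, b, hg, ha, hb, EuclideanDomain.gcdA x y, EuclideanDomain.gcdB x y, ?_⟩
  apply mul_left_cancel₀ hg
  linear_combination -hbez - EuclideanDomain.gcdA x y * ha - EuclideanDomain.gcdB x y * hb

lemma pair_bound {N : ℕ} {s s' u D : F2[X]} (hs : s ∈ GZ (N / 4)) (hs' : s' ∈ GZ (N / 8))
    (hD : D ≠ 0) (huD : IsCoprime u D) (C : Finset (F2[X] × F2[X]))
    (hC : ∀ p ∈ C, p.1.degree < s.degree ∧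
      pK p.1 / pK s + pK p.2 / pK s' = pK u / pK D) :
    |alphaA s| * |alphaB s'| * (C.card : ℝ) ≤
      ∑ L ∈ ((GZ N).filter (fun L => D ∣ L)).filter (fun L => s ∣ L ∧ s' ∣ L), wt 3 L := by
  rcases C.eq_empty_or_nonempty with rfl | ⟨q, hq⟩
  · simp only [Finset.card_empty, Nat.cast_zero, mul_zero]
    exact Finset.sum_nonneg fun _ _ => wt_nonneg _ _
  rw [mem_GZ] at hs hs'
  obtain ⟨g, a, b, hg, rfl, rfl, hab⟩ := exists_gcd_form s hs'.1
  have ha : a ≠ 0 := right_ne_zero_of_mul hs.1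
  have hb : b ≠ 0 := right_ne_zero_of_mul hs'.1
  have hcard := card_pairs_le hg ha hb hab C _ hC
  have hL0 : g * a * b ≠ 0 := mul_ne_zero hs.1 hb
  have hdL : D ∣ g * a * b := by
    have h1 := (hC q hq).2
    have e1 := pK_ne hg
    have e2 := pK_ne ha
    have e3 := pK_ne hb
    have e4 := pK_ne hD
    have h2 : (q.1 * b + q.2 * a) * D = u * (g * a * b) := by
      apply pK_inj
      simp only [map_mul, map_add] at h1 ⊢
      field_simp at h1
      linear_combination h1
    apply huD.symm.dvd_of_dvd_mul_left
    exact ⟨q.1 * b + q.2 * a, by rw [← h2, mul_comm]⟩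
  have hLm : g * a * b ∈ ((GZ N).filter (fun L => D ∣ L)).filter
      (fun L => g * a ∣ L ∧ g * b ∣ L) := by
    rw [Finset.mem_filter, Finset.mem_filter, mem_GZ]
    refine ⟨⟨⟨hL0, ?_⟩, hdL⟩, ⟨b, rfl⟩, ⟨a, by ring⟩⟩
    have h1 := hs.2
    have h2 := hs'.2
    rw [Polynomial.natDegree_mul hg hb] at h2
    rw [Polynomial.natDegree_mul hs.1 hb]
    omega
  refine le_trans ?_ (Finset.single_le_sum (f := wt 3) (fun _ _ => wt_nonneg _ _) hLm)
  have hA := abs_alphaA_le hs.1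
  have hB := abs_alphaB_le (s := g * b)
  have t1 : (tau (g * a) : ℝ) ≤ tau (g * a * b) := by
    exact_mod_cast tau_mono hL0 ⟨b, rfl⟩
  have t2 : (tau (g * b) : ℝ) ≤ tau (g * a * b) := by
    exact_mod_cast tau_mono hL0 ⟨a, by ring⟩
  have hcard' : (C.card : ℝ) ≤ 2 ^ g.natDegree := by exact_mod_cast hcard
  calc |alphaA (g * a)| * |alphaB (g * b)| * (C.card : ℝ)
      ≤ wt 1 (g * a) * wt 2 (g * b) * 2 ^ g.natDegree := by
        have := wt_nonneg 1 (g * a)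
        have := wt_nonneg 2 (g * b)
        gcongr
    _ = (tau (g * a) : ℝ) * (tau (g * b) : ℝ) ^ 2 / 2 ^ (g * a * b).natDegree := by
        unfold wt
        rw [Polynomial.natDegree_mul hs.1 hb, Polynomial.natDegree_mul hg ha,
          Polynomial.natDegree_mul hg hb, pow_add, pow_add, pow_add]
        field_simp
        ring
    _ ≤ (tau (g * a * b) : ℝ) * (tau (g * a * b) : ℝ) ^ 2 / 2 ^ (g * a * b).natDegree := by
        gcongr
    _ = wt 3 (g * a * b) := by
        unfold wt
        ring

lemma count_divisors {N M : ℕ} {L : F2[X]} (hL : L ∈ GZ N) :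
    (((GZ M).filter (fun s => s ∣ L)).card : ℝ) ≤ tau L := by
  unfold tau
  norm_cast
  apply Finset.card_le_card
  intro d hd
  rw [mem_tau (mem_GZ.1 hL).1]
  exact (Finset.mem_filter.1 hd).2

lemma total_bound (N : ℕ) {D : F2[X]} (hD : D ≠ 0) :
    ∑ s ∈ GZ (N / 4), ∑ s' ∈ GZ (N / 8),
      ∑ L ∈ ((GZ N).filter (fun L => D ∣ L)).filter (fun L => s ∣ L ∧ s' ∣ L), wt 3 L
      ≤ wt 5 D * (N : ℝ) ^ 32 := by
  calc _ = ∑ L ∈ (GZ N).filter (fun L => D ∣ L), ∑ s ∈ GZ (N / 4), ∑ s' ∈ GZ (N / 8),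
        (if s ∣ L ∧ s' ∣ L then wt 3 L else 0) := by
        conv_rhs => rw [Finset.sum_comm]
        refine Finset.sum_congr rfl fun s _ => ?_
        conv_rhs => rw [Finset.sum_comm]
        refine Finset.sum_congr rfl fun s' _ => ?_
        rw [Finset.sum_filter]
    _ ≤ ∑ L ∈ (GZ N).filter (fun L => D ∣ L), wt 5 L := by
        refine Finset.sum_le_sum fun L hL => ?_
        have hL' := (Finset.mem_filter.1 hL).1
        have h1 := count_divisors (M := N / 4) hL'
        have h2 := count_divisors (M := N / 8) hL'
        have h3 := wt_nonneg 3 L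
        calc ∑ s ∈ GZ (N / 4), ∑ s' ∈ GZ (N / 8), (if s ∣ L ∧ s' ∣ L then wt 3 L else 0)
            = ∑ s ∈ GZ (N / 4), ∑ s' ∈ GZ (N / 8),
              (if s ∣ L then 1 else 0) * (if s' ∣ L then 1 else 0) * wt 3 L := by
              refine Finset.sum_congr rfl fun s _ => Finset.sum_congr rfl fun s' _ => ?_
              by_cases c1 : s ∣ L <;> by_cases c2 : s' ∣ L <;> simp [c1, c2]
          _ = (((GZ (N / 4)).filter (fun s => s ∣ L)).card : ℝ) *
              (((GZ (N / 8)).filter (fun s => s ∣ L)).card : ℝ) * wt 3 L := by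
              simp only [← Finset.sum_mul]
              rw [← Finset.sum_mul_sum, Finset.sum_boole, Finset.sum_boole]
          _ ≤ (tau L : ℝ) * (tau L : ℝ) * wt 3 L := by gcongr
          _ = wt 5 L := by unfold wt; ring
    _ ≤ wt 5 D * Ssum 5 N := sum_dvd_le 5 N hD
    _ ≤ wt 5 D * (N : ℝ) ^ 32 := by
        have := Ssum_le 5 N
        norm_num at this
        exact mul_le_mul_of_nonneg_left this (wt_nonneg _ _)

lemma expand_sum (N R Q : ℕ) (θ : Kinf) :
    ∑ f ∈ GN N, LambdaM R (f + 1) * HM Q f * eKr (polyToK f * θ) =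
    ∑ s ∈ GN R, ∑ s' ∈ GN Q, alphaA s * alphaB s' *
      ∑ p ∈ residues s ×ˢ residues s', eKr (pK p.1 / pK s) *
        Esum N (pK p.1 / pK s + pK p.2 / pK s' + θ) := by
  have h1 : ∀ f, LambdaM R (f + 1) * HM Q f * eKr (polyToK f * θ) =
      ∑ s ∈ GN R, ∑ s' ∈ GN Q, ∑ p ∈ residues s ×ˢ residues s', alphaA s * alphaB s' *
        (eKr (pK p.1 / pK s) * eKr (pK f * (pK p.1 / pK s + pK p.2 / pK s' + θ))) := by
    intro f
    unfold LambdaM HM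
    rw [Finset.sum_mul_sum, Finset.sum_mul]
    refine Finset.sum_congr rfl fun s _ => ?_
    rw [Finset.sum_mul]
    refine Finset.sum_congr rfl fun s' _ => ?_
    rw [mul_mul_mul_comm, Finset.sum_mul_sum, ← Finset.sum_product', mul_assoc, Finset.sum_mul,
      Finset.mul_sum]
    refine Finset.sum_congr rfl fun p _ => ?_
    simp only [polyToK_eq, ratK_eq, mul_add, map_add, map_one, add_mul, one_mul, eKr_add]
    ring
  simp only [h1]
  rw [Finset.sum_comm]
  refine Finset.sum_congr rfl fun s _ => ?_
  rw [Finset.sum_comm]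
  refine Finset.sum_congr rfl fun s' _ => ?_
  rw [Finset.sum_comm, Finset.mul_sum]
  refine Finset.sum_congr rfl fun p _ => ?_
  unfold Esum
  rw [Finset.mul_sum, Finset.mul_sum]

/-- pairs of residues contributing to the sum -/
def pairsC (N : ℕ) (θ : Kinf) (s s' : F2[X]) : Finset (F2[X] × F2[X]) :=
  (residues s ×ˢ residues s').filter
    (fun p => Near N (pK p.1 / pK s + pK p.2 / pK s' + θ))

lemma sum_GN_eq (M : ℕ) (F : F2[X] → ℝ) (h : F 0 = 0) : ∑ s ∈ GN M, F s = ∑ s ∈ GZ M, F s := by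
  unfold GZ
  rw [Finset.sum_filter]
  refine Finset.sum_congr rfl fun s _ => ?_
  by_cases hs : s = 0
  · subst hs; simp [h]
  · simp [hs]

lemma abs_sum_le (N : ℕ) (θ : Kinf) :
    |∑ f ∈ GN N, LambdaM (N / 4) (f + 1) * HM (N / 8) f * eKr (polyToK f * θ)| ≤
    2 ^ N * ∑ s ∈ GZ (N / 4), ∑ s' ∈ GZ (N / 8),
      |alphaA s| * |alphaB s'| * ((pairsC N θ s s').card : ℝ) := by
  rw [expand_sum, sum_GN_eq _ _ (by simp [alphaA_zero]), Finset.mul_sum]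
  refine (Finset.abs_sum_le_sum_abs _ _).trans (Finset.sum_le_sum fun s _ => ?_)
  rw [sum_GN_eq _ _ (by simp [alphaB_zero]), Finset.mul_sum]
  refine (Finset.abs_sum_le_sum_abs _ _).trans (Finset.sum_le_sum fun s' _ => ?_)
  rw [abs_mul, abs_mul, mul_comm ((2 : ℝ) ^ N), mul_assoc (|alphaA s| * |alphaB s'|)]
  refine mul_le_mul_of_nonneg_left ?_ (by positivity)
  refine (Finset.abs_sum_le_sum_abs _ _).trans ?_
  unfold pairsC
  rw [← nsmul_eq_mul, ← Finset.sum_const, Finset.sum_filter]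
  refine Finset.sum_le_sum fun p _ => ?_
  rw [abs_mul, abs_eKr, one_mul]
  split_ifs with h
  · exact abs_Esum_le _ _
  · rw [Esum_eq_zero _ _ h, abs_zero]

lemma residues_degree {s t : F2[X]} (hs : s ≠ 0) (ht : t ∈ residues s) : t.degree < s.degree := by
  unfold residues at ht
  rw [Finset.mem_filter, mem_GN, ← Polynomial.degree_eq_natDegree hs] at ht
  exact ht.1

lemma structure_lemma (N : ℕ) (θ : Kinf) (hθ : InT θ)
    (h : 0 < |∑ f ∈ GN N, LambdaM (N / 4) (f + 1) * HM (N / 8) f * eKr (polyToK f * θ)|) :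
    ∃ u D : F2[X], D ∈ GZ N ∧ ordK (θ - ratK u D) < ((-(N : ℤ) : ℤ) : WithBot ℤ) ∧
      |∑ f ∈ GN N, LambdaM (N / 4) (f + 1) * HM (N / 8) f * eKr (polyToK f * θ)| ≤
        2 ^ N * (wt 5 D * (N : ℝ) ^ 32) := by
  have hb := abs_sum_le N θ
  by_cases hex : ∃ s ∈ GZ (N / 4), ∃ s' ∈ GZ (N / 8), (pairsC N θ s s').Nonempty
  · obtain ⟨s0, hs0, s0', hs0', ⟨t0, t0'⟩, hp0⟩ := hex
    unfold pairsC at hp0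
    rw [Finset.mem_filter, Finset.mem_product] at hp0
    obtain ⟨⟨ht0, ht0'⟩, hnear⟩ := hp0
    simp only at ht0 ht0' hnear
    have z0 := (mem_GZ.1 hs0)
    have z0' := (mem_GZ.1 hs0')
    have e1 := pK_ne z0.1
    have e2 := pK_ne z0'.1
    obtain ⟨g, u, D, hg, hu, hDe, huD⟩ :=
      exists_gcd_form (t0 * s0' + t0' * s0) (mul_ne_zero z0.1 z0'.1)
    have hss : s0 * s0' ≠ 0 := mul_ne_zero z0.1 z0'.1
    have hD : D ≠ 0 := by
      rw [hDe] at hss; exact right_ne_zero_of_mul hss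
    have hlam : pK t0 / pK s0 + pK t0' / pK s0' = pK u / pK D := by
      rw [div_add_div _ _ e1 e2, ← map_mul, ← map_mul, ← map_mul, ← map_add, hDe, mul_comm s0 t0',
        hu, map_mul, map_mul, mul_div_mul_left _ _ (pK_ne hg)]
    refine ⟨u, D, ?_, ?_, ?_⟩
    · rw [mem_GZ]
      refine ⟨hD, ?_⟩
      have h1 := Polynomial.natDegree_le_of_dvd (⟨g, by rw [hDe, mul_comm]⟩ : D ∣ s0 * s0') hss
      have h2 := Polynomial.natDegree_mul_le (p := s0) (q := s0')
      omega
    · apply ordK_lt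
      intro j hj
      have hsub : θ - ratK u D = pK t0 / pK s0 + pK t0' / pK s0' + θ := by
        have hneg : pK u = -pK u := by rw [← map_neg, CharTwo.neg_eq]
        rw [ratK_eq, hlam, sub_eq_add_neg, ← neg_div, ← hneg, add_comm]
      rw [hsub]
      by_cases hj1 : 1 ≤ j
      · exact hnear j hj1 hj
      · have hj0 : j ≤ 0 := by omega
        rw [HahnSeries.coeff_add, HahnSeries.coeff_add, InT_coeff hθ hj0,
          coeff_ratio z0.1 (residues_degree z0.1 ht0) hj0,
          coeff_ratio z0'.1 (residues_degree z0'.1 ht0') hj0]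
        simp
    · refine hb.trans (mul_le_mul_of_nonneg_left ?_ (by positivity))
      refine le_trans ?_ (total_bound N hD)
      refine Finset.sum_le_sum fun s hs => Finset.sum_le_sum fun s' hs' => ?_
      refine pair_bound hs hs' hD huD _ ?_
      rintro ⟨t, t'⟩ hp
      unfold pairsC at hp
      rw [Finset.mem_filter, Finset.mem_product] at hp
      refine ⟨residues_degree (mem_GZ.1 hs).1 hp.1.1, ?_⟩
      rw [← hlam]
      exact near_eq s t s' t' s0 t0 s0' t0' θ hs hs' hs0 hs0' hp.1.1 hp.1.2 ht0 ht0' hp.2 hnear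
  · exfalso
    push Not at hex
    have : ∑ s ∈ GZ (N / 4), ∑ s' ∈ GZ (N / 8),
      |alphaA s| * |alphaB s'| * ((pairsC N θ s s').card : ℝ) = 0 := by
      refine Finset.sum_eq_zero fun s hs => Finset.sum_eq_zero fun s' hs' => ?_
      rw [hex s hs s' hs']
      simp
    rw [this, mul_zero] at hb
    linarith

lemma final_bound (ε : ℝ) (p : ℕ) (hp : 1 ≤ ε * p) (hp0 : 0 < p) (N d T : ℕ) (hN : 2 ≤ N)
    (hT : 1 ≤ T) (K : ℝ) (hε : 0 < ε)
    (h1 : (1 / 3) * (2 : ℝ) ^ ((N : ℝ) - K) ≤ 2 ^ N * ((T : ℝ) ^ 5 / 2 ^ d * (N : ℝ) ^ 32))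
    (h2 : (T : ℝ) ^ (5 * (p + 1)) / 2 ^ d ≤ (N : ℝ) ^ (2 ^ (5 * (p + 1)))) :
    (d : ℝ) ≤ (1 + ε) * K +
      ((1 + ε) * ((((2 ^ (5 * (p + 1)) : ℕ) : ℝ) + 34 * (p + 1)) / Real.log 2)) * Real.log N := by
  have hc : 0 < Real.log 2 := Real.log_pos (by norm_num)
  have hN0 : (0 : ℝ) < N := by positivity
  have hT0 : (0 : ℝ) < T := by exact_mod_cast hT
  have hl : Real.log 2 ≤ Real.log N := Real.log_le_log (by norm_num) (by exact_mod_cast hN)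
  have hl3 : Real.log 3 ≤ 2 * Real.log 2 := by
    have : (2 : ℝ) * Real.log 2 = Real.log (2 ^ 2) := by rw [Real.log_pow]; norm_num
    rw [this]
    exact Real.log_le_log (by norm_num) (by norm_num)
  have g1 := Real.log_le_log (by positivity) h1
  rw [Real.log_mul (by norm_num) (by positivity), Real.log_rpow (by norm_num),
    Real.log_mul (by positivity) (by positivity), Real.log_mul (by positivity) (by positivity),
    Real.log_div (x := (T : ℝ) ^ 5) (by positivity) (by positivity), one_div, Real.log_inv,
    Real.log_pow, Real.log_pow,
    Real.log_pow, Real.log_pow] at g1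
  have g2 := Real.log_le_log (by positivity) h2
  rw [Real.log_div (by positivity) (by positivity), Real.log_pow, Real.log_pow, Real.log_pow] at g2
  set B : ℝ := ((2 ^ (5 * (p + 1)) : ℕ) : ℝ) with hB
  have hB0 : 0 ≤ B := by positivity
  push_cast at g1 g2
  set c := Real.log 2
  set l := Real.log N
  set x := Real.log T
  have hp1 : (1 : ℝ) ≤ p := by exact_mod_cast hp0
  set P : ℝ := (p : ℝ) with hPdef
  have hd : (0 : ℝ) ≤ d := by positivity
  set C2 := (B + 34 * (P + 1)) / c with hC2
  have hC2c : C2 * c = B + 34 * (P + 1) := by rw [hC2]; field_simp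
  have hC20 : 0 ≤ C2 := by positivity
  have hl0 : 0 ≤ l := hc.le.trans hl
  have key : P * d * c ≤ ((P + 1) * K + C2 * l) * c := by
    have : (P + 1) * (-(2 * l) + (N - K) * c) ≤ (P + 1) * (N * c + (5 * x - d * c + 32 * l)) := by
      apply mul_le_mul_of_nonneg_left _ (by linarith)
      linarith
    nlinarith [hC2c]
  have key2 : P * d ≤ (P + 1) * K + C2 * l := le_of_mul_le_mul_right key hc
  have hCl : 0 ≤ C2 * l := by positivity
  have hPpos : 0 < P := by linarith
  apply le_of_mul_le_mul_left _ hPpos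
  refine key2.trans ?_
  rcases le_total 0 K with hK | hK
  · nlinarith [mul_nonneg (sub_nonneg.2 hp) hK, mul_nonneg hε.le hCl, mul_nonneg hPpos.le hCl,
      mul_nonneg (sub_nonneg.2 hp1) hCl, mul_nonneg hε.le (mul_nonneg hPpos.le hCl)]
  · have hK2 : (P + 1) * (-K) ≤ C2 * l := by nlinarith [mul_nonneg hPpos.le hd]
    have hK3 : P * (-K) ≤ C2 * l := by linarith
    nlinarith [mul_nonneg (sub_nonneg.2 hp) (neg_nonneg.2 hK), mul_nonneg hε.le hCl,
      mul_nonneg (sub_nonneg.2 hp1) hCl, mul_nonneg hε.le (mul_nonneg (sub_nonneg.2 hp1) hCl),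
      mul_nonneg hε.le (sub_nonneg.2 hK3)]

/-- With `K = (1/8−ε)N`, `R = N/4`, `Q = N/8`: if `θ ∈ T` satisfies
`|Σ_{f∈G_N} Λ_R(f+1)H_Q(f) e(fθ)| ≥ (1/3)·2^{N−K}`, then there are polynomials `u, s`
with `deg s ≤ (1+ε)K + O_ε(log N)` and `ord(θ − u/s) < −N`. -/
theorem statement_12 (ε : ℝ) (hε : 0 < ε) :
    ∃ C : ℝ, ∀ N : ℕ, 2 ≤ N → ∀ θ : Kinf, InT θ →
      (1 / 3) * (2 : ℝ) ^ ((N : ℝ) - (1 / 8 - ε) * (N : ℝ)) ≤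
        |∑ f ∈ GN N, LambdaM (N / 4) (f + 1) * HM (N / 8) f * eKr (polyToK f * θ)| →
      ∃ u s : F2[X], s ≠ 0 ∧
        (s.natDegree : ℝ) ≤ (1 + ε) * ((1 / 8 - ε) * (N : ℝ)) + C * Real.log (N : ℝ) ∧
        ordK (θ - ratK u s) < ((-(N : ℤ) : ℤ) : WithBot ℤ) := by
  obtain ⟨p, hp⟩ := exists_nat_gt (1 / ε)
  have hp0 : 0 < p := by
    have : (0 : ℝ) < p := lt_trans (by positivity) hp
    exact_mod_cast this
  have hp1 : 1 ≤ ε * p := by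
    rw [div_lt_iff₀ hε] at hp
    linarith
  refine ⟨(1 + ε) * ((((2 ^ (5 * (p + 1)) : ℕ) : ℝ) + 34 * (p + 1)) / Real.log 2), ?_⟩
  intro N hN θ hθ h
  obtain ⟨u, D, hD, hord, hb⟩ := structure_lemma N θ hθ (lt_of_lt_of_le (by positivity) h)
  have hD0 := (mem_GZ.1 hD).1
  refine ⟨u, D, hD0, ?_, hord⟩
  exact final_bound ε p hp1 hp0 N D.natDegree (tau D) hN (one_le_tau hD0) _ hε (h.trans hb)
    (wt_le (5 * (p + 1)) N hD)
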